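/- Let Σ = {c_1, …, c_σ}, let n ≥ 1 and let n_1, …, n_σ be nonnegative integers with n_1 + … + n_σ = n − 1. Let 𝓤 be the set of tries over Σ with n nodes and symbol distribution (n_1, …, n_σ), and define f : 𝓤 → 𝓜 by: list the elements of a trie S in lexicographic order s_1 < … < s_n (where a string precedes its proper extensions; this order coincides with the pre-order visit of the trie), and set f(S)[i][j] = 1 if and only if s_j·c_i ∈ S. Then f is injective, and a matrix M ∈ 𝓜 belongs to the image f(𝓤) if and only if its associated sequence L is a Łukasiewicz path. -/

import Mathlib

/-- Number of ones in column `t` of the boolean matrix `M`. -/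
def colOnes (σ n : ℕ) (M : Fin σ → Fin n → Bool) (t : Fin n) : ℕ :=
  (Finset.univ.filter fun i => M i t = true).card

/-- The sequence `L` associated with a matrix: `L j = ∑_{t=1}^{j} (colOnes t − 1)`. -/
def Lseq (σ n : ℕ) (M : Fin σ → Fin n → Bool) (j : ℕ) : ℤ :=
  ∑ t ∈ Finset.univ.filter (fun t : Fin n => (t : ℕ) < j),
    ((colOnes σ n M t : ℤ) - 1)

/-- `L[1..n]` is a Łukasiewicz path. -/
def IsLukasiewicz (n : ℕ) (L : ℕ → ℤ) : Prop :=
  L n = -1 ∧ (∀ j, 1 ≤ j → j ≤ n - 1 → 0 ≤ L j) ∧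
    (∀ j, 1 ≤ j → j ≤ n - 1 → -1 ≤ L (j + 1) - L j)

/-- The matrix `f(S)` of a trie `S`: list the nodes of `S` in the lexicographic
order on `List (Fin σ)` (in which a string precedes its proper extensions, i.e.
pre-order), obtaining `s_1 ≤ … ≤ s_n`; then `f(S)[i][j] = 1` iff `s_j · c_i ∈ S`. -/
def trieMatrix (σ n : ℕ) (S : Finset (List (Fin σ))) : Fin σ → Fin n → Bool :=
  fun i j => decide (((S.sort (· ≤ ·)).getD (j : ℕ) []) ++ [i] ∈ S)

/-- Every string strictly precedes its one-letter extensions. -/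
theorem lt_append_singleton {α : Type*} [LinearOrder α] (s : List α) (c : α) : s < s ++ [c] := by
  induction s with
  | nil => exact List.nil_lt_cons c []
  | cons a s ih => exact List.cons_lt_cons_iff.mpr (Or.inr ⟨rfl, ih⟩)

theorem Lseq_zero (σ n : ℕ) (M : Fin σ → Fin n → Bool) : Lseq σ n M 0 = 0 := by
  simp [Lseq]

theorem Lseq_succ (σ n : ℕ) (M : Fin σ → Fin n → Bool) {j : ℕ} (hj : j < n) :
    Lseq σ n M (j + 1) = Lseq σ n M j + ((colOnes σ n M ⟨j, hj⟩ : ℤ) - 1) := by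
  unfold Lseq
  have h : (Finset.univ.filter fun t : Fin n => (t : ℕ) < j + 1) =
      insert ⟨j, hj⟩ (Finset.univ.filter fun t : Fin n => (t : ℕ) < j) := by
    ext t
    simp only [Finset.mem_filter, Finset.mem_univ, true_and, Finset.mem_insert, Fin.ext_iff]
    omega
  rw [h, Finset.sum_insert (by simp)]
  ring

/-- `L j + j` counts the ones in the first `j` columns. -/
theorem Lseq_add_eq_card (σ n : ℕ) (M : Fin σ → Fin n → Bool) {j : ℕ} (hj : j ≤ n) :
    Lseq σ n M j + j =
      ((Finset.univ.filter fun p : Fin n × Fin σ =>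
        (p.1 : ℕ) < j ∧ M p.2 p.1 = true).card : ℤ) := by
  have hcard : (Finset.univ.filter fun p : Fin n × Fin σ =>
      (p.1 : ℕ) < j ∧ M p.2 p.1 = true).card =
      ∑ t ∈ Finset.univ.filter (fun t : Fin n => (t : ℕ) < j), colOnes σ n M t := by
    simp only [colOnes, Finset.card_filter, Fintype.sum_prod_type, Finset.sum_filter]
    refine Finset.sum_congr rfl fun t _ => ?_
    by_cases h : (t : ℕ) < j <;> simp [h]
  have hlen : (Finset.univ.filter fun t : Fin n => (t : ℕ) < j).card = j := by
    simp [Fin.card_filter_val_lt, hj]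
  rw [hcard, Lseq, Finset.sum_sub_distrib]
  simp [hlen]

theorem Lseq_eq_neg_one (σ n : ℕ) (hn : 1 ≤ n) (nd : Fin σ → ℕ) (hsum : ∑ i, nd i = n - 1)
    (M : Fin σ → Fin n → Bool)
    (hM : ∀ i, (Finset.univ.filter fun j => M i j = true).card = nd i) :
    Lseq σ n M n = -1 := by
  have h := Lseq_add_eq_card σ n M le_rfl
  have hcard : (Finset.univ.filter fun p : Fin n × Fin σ =>
      (p.1 : ℕ) < n ∧ M p.2 p.1 = true).card = ∑ i, nd i := by
    simp only [← hM, Finset.card_filter, Fintype.sum_prod_type_right, Fin.is_lt, true_and]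
  rw [hcard, hsum] at h
  omega

/-- In a trie listed in increasing order, every node but the first one is a child of an
earlier node. -/
theorem exists_parent_lt {σ n : ℕ} {S : Finset (List (Fin σ))} (hS : S.card = n)
    (hpre : ∀ (s : List (Fin σ)) (c : Fin σ), s ++ [c] ∈ S → s ∈ S) (j : Fin n) (hj : 0 < (j : ℕ)) :
    ∃ i < j, ∃ c, S.orderEmbOfFin hS j = S.orderEmbOfFin hS i ++ [c] := by
  have hmem := S.orderEmbOfFin_mem hS j
  have hsurj : ∀ x ∈ S, ∃ i, S.orderEmbOfFin hS i = x := fun x hx => by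
    have : x ∈ Set.range (S.orderEmbOfFin hS) := by
      rw [Finset.range_orderEmbOfFin]; exact hx
    exact this
  rcases List.eq_nil_or_concat (S.orderEmbOfFin hS j) with h | ⟨p, c, h⟩
  · exfalso
    have hlt : S.orderEmbOfFin hS ⟨0, by omega⟩ < S.orderEmbOfFin hS j :=
      (S.orderEmbOfFin hS).strictMono (Fin.lt_def.mpr hj)
    rw [h] at hlt
    exact List.not_lt_nil _ hlt
  · rw [List.concat_eq_append] at h
    rw [h] at hmem
    obtain ⟨i, rfl⟩ := hsurj p (hpre p c hmem)
    refine ⟨i, ?_, c, h⟩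
    rw [← (S.orderEmbOfFin hS).lt_iff_lt, h]
    exact lt_append_singleton _ _

theorem trieMatrix_eq_true_iff {σ n : ℕ} {S : Finset (List (Fin σ))} (hS : S.card = n)
    (i : Fin σ) (j : Fin n) :
    trieMatrix σ n S i j = true ↔ S.orderEmbOfFin hS j ++ [i] ∈ S := by
  have hj : (j : ℕ) < (S.sort (· ≤ ·)).length := by
    rw [Finset.length_sort, hS]; exact j.2
  simp only [trieMatrix, decide_eq_true_eq, Finset.orderEmbOfFin_apply,
    List.getD_eq_getElem _ _ hj]
  exact Iff.rfl

/-- Induction step for injectivity: the next node of `S` is at most the next node of `T`. -/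
theorem orderEmbOfFin_le_of_trieMatrix_eq {σ n : ℕ} {S T : Finset (List (Fin σ))}
    (hS : S.card = n) (hT : T.card = n) (hTnil : [] ∈ T)
    (hTpre : ∀ (s : List (Fin σ)) (c : Fin σ), s ++ [c] ∈ T → s ∈ T) (hSnil : [] ∈ S)
    (hM : trieMatrix σ n S = trieMatrix σ n T) (j : Fin n)
    (ih : ∀ i < j, S.orderEmbOfFin hS i = T.orderEmbOfFin hT i) :
    S.orderEmbOfFin hS j ≤ T.orderEmbOfFin hT j := by
  have key : T.orderEmbOfFin hT j ∈ S := by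
    by_cases hj : 0 < (j : ℕ)
    · obtain ⟨i, hij, c, h⟩ := exists_parent_lt hT hTpre j hj
      have hmem := T.orderEmbOfFin_mem hT j
      rw [h, ← trieMatrix_eq_true_iff hT, ← hM, trieMatrix_eq_true_iff hS] at hmem
      rwa [h, ← ih i hij]
    · have : T.orderEmbOfFin hT j = [] := by
        have hr : ([] : List (Fin σ)) ∈ Set.range (T.orderEmbOfFin hT) := by
          rw [Finset.range_orderEmbOfFin]; exact hTnil
        obtain ⟨k, hk⟩ := hr
        have hle : T.orderEmbOfFin hT j ≤ T.orderEmbOfFin hT k :=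
          (T.orderEmbOfFin hT).monotone (Fin.le_def.mpr (by omega))
        rw [hk] at hle
        by_contra hne
        rcases hle.lt_or_eq with h | h
        · exact List.not_lt_nil _ h
        · exact hne h
      rwa [this]
  have hr : T.orderEmbOfFin hT j ∈ Set.range (S.orderEmbOfFin hS) := by
    rw [Finset.range_orderEmbOfFin]; exact key
  obtain ⟨k, hk⟩ := hr
  rw [← hk]
  refine (S.orderEmbOfFin hS).monotone ?_
  by_contra hkj
  rw [not_le] at hkj
  rw [ih k hkj] at hk
  exact hkj.ne ((T.orderEmbOfFin hT).injective hk)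

theorem eq_of_trieMatrix_eq {σ n : ℕ} {S T : Finset (List (Fin σ))}
    (hS : S.card = n) (hSnil : [] ∈ S)
    (hSpre : ∀ (s : List (Fin σ)) (c : Fin σ), s ++ [c] ∈ S → s ∈ S)
    (hT : T.card = n) (hTnil : [] ∈ T)
    (hTpre : ∀ (s : List (Fin σ)) (c : Fin σ), s ++ [c] ∈ T → s ∈ T)
    (hM : trieMatrix σ n S = trieMatrix σ n T) : S = T := by
  have h : ∀ j : Fin n, S.orderEmbOfFin hS j = T.orderEmbOfFin hT j := by
    intro j
    induction j using WellFoundedLT.induction with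
    | ind j ih =>
      exact le_antisymm
        (orderEmbOfFin_le_of_trieMatrix_eq hS hT hTnil hTpre hSnil hM j ih)
        (orderEmbOfFin_le_of_trieMatrix_eq hT hS hSnil hSpre hTnil hM.symm j
          fun i hi => (ih i hi).symm)
  rw [← Finset.coe_inj, ← S.range_orderEmbOfFin hS, ← T.range_orderEmbOfFin hT]
  congr 1
  exact funext h

theorem Lseq_trieMatrix_nonneg {σ n : ℕ} {S : Finset (List (Fin σ))} (hS : S.card = n)
    (hpre : ∀ (s : List (Fin σ)) (c : Fin σ), s ++ [c] ∈ S → s ∈ S)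
    {j : ℕ} (hj : j < n) : 0 ≤ Lseq σ n (trieMatrix σ n S) j := by
  have h := Lseq_add_eq_card σ n (trieMatrix σ n S) hj.le
  set A := Finset.univ.filter fun p : Fin n × Fin σ =>
    (p.1 : ℕ) < j ∧ trieMatrix σ n S p.2 p.1 = true with hA
  let B : Finset (Fin n) := Finset.Ioc ⟨0, by omega⟩ ⟨j, hj⟩
  have hB : B.card = j := by simp [B]
  have hsub : B.image (S.orderEmbOfFin hS) ⊆
      A.image fun p => S.orderEmbOfFin hS p.1 ++ [p.2] := by
    intro x hx
    obtain ⟨t, ht, rfl⟩ := Finset.mem_image.mp hx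
    simp only [B, Finset.mem_Ioc, Fin.lt_def, Fin.le_def] at ht
    obtain ⟨i, hi, c, hc⟩ := exists_parent_lt hS hpre t ht.1
    refine Finset.mem_image.mpr ⟨(i, c), ?_, hc.symm⟩
    rw [hA, Finset.mem_filter]
    refine ⟨Finset.mem_univ _, lt_of_lt_of_le hi ht.2, ?_⟩
    rw [trieMatrix_eq_true_iff hS, ← hc]
    exact S.orderEmbOfFin_mem hS t
  have hle := (Finset.card_le_card hsub).trans Finset.card_image_le
  rw [Finset.card_image_of_injective _ (S.orderEmbOfFin hS).injective, hB] at hle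
  omega

/-- The least string of a finite set, or `[]` if the set is empty. -/
def leastString {σ : ℕ} (P : Finset (List (Fin σ))) : List (Fin σ) :=
  if h : P.Nonempty then P.min' h else []

theorem leastString_mem {σ : ℕ} {P : Finset (List (Fin σ))} (h : P.Nonempty) :
    leastString P ∈ P := by
  rw [leastString, dif_pos h]; exact P.min'_mem h

theorem leastString_le {σ : ℕ} {P : Finset (List (Fin σ))} {x : List (Fin σ)} (hx : x ∈ P) :
    leastString P ≤ x := by
  rw [leastString, dif_pos ⟨x, hx⟩]; exact P.min'_le x hx

/-- The nodes discovered but not yet visited after `j` steps of the pre-order reconstruction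
of a trie, where the `j`-th visited node has the children prescribed by `C j`. -/
def pending {σ : ℕ} (C : ℕ → Finset (Fin σ)) : ℕ → Finset (List (Fin σ))
  | 0 => {[]}
  | j + 1 => (pending C j).erase (leastString (pending C j)) ∪
      (C j).image fun c => leastString (pending C j) ++ [c]

/-- The `j`-th node visited by the pre-order reconstruction. -/
def visited {σ : ℕ} (C : ℕ → Finset (Fin σ)) (j : ℕ) : List (Fin σ) :=
  leastString (pending C j)

theorem mem_pending_succ {σ : ℕ} {C : ℕ → Finset (Fin σ)} {j : ℕ} {x : List (Fin σ)} :
    x ∈ pending C (j + 1) ↔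
      (x ≠ visited C j ∧ x ∈ pending C j) ∨ ∃ c ∈ C j, visited C j ++ [c] = x := by
  simp [pending, visited]

theorem visited_lt_of_mem_pending_succ {σ : ℕ} {C : ℕ → Finset (Fin σ)} {j : ℕ}
    {x : List (Fin σ)} (hx : x ∈ pending C (j + 1)) : visited C j < x := by
  rcases mem_pending_succ.mp hx with ⟨hne, hmem⟩ | ⟨c, -, rfl⟩
  · exact lt_of_le_of_ne (leastString_le hmem) hne.symm
  · exact lt_append_singleton _ _

theorem visited_strictMonoOn {σ n : ℕ} {C : ℕ → Finset (Fin σ)}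
    (hne : ∀ j < n, (pending C j).Nonempty) {i j : ℕ} (hij : i < j) (hj : j < n) :
    visited C i < visited C j := by
  induction j, hij using Nat.le_induction with
  | base => exact visited_lt_of_mem_pending_succ (leastString_mem (hne _ hj))
  | succ j _ ih =>
    exact (ih (by omega)).trans (visited_lt_of_mem_pending_succ (leastString_mem (hne _ hj)))

/-- Discovered nodes other than the root are prescribed children of visited nodes. -/
theorem eq_nil_or_child_of_mem_pending {σ : ℕ} {C : ℕ → Finset (Fin σ)} {j : ℕ}
    {x : List (Fin σ)} (hx : x ∈ pending C j) :
    x = [] ∨ ∃ i < j, ∃ c ∈ C i, visited C i ++ [c] = x := by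
  induction j with
  | zero => exact Or.inl (by simpa [pending] using hx)
  | succ j ih =>
    rcases mem_pending_succ.mp hx with ⟨-, hmem⟩ | ⟨c, hc, h⟩
    · rcases ih hmem with h | ⟨i, hi, h⟩
      · exact Or.inl h
      · exact Or.inr ⟨i, by omega, h⟩
    · exact Or.inr ⟨j, by omega, c, hc, h⟩

theorem card_pending_succ {σ : ℕ} {C : ℕ → Finset (Fin σ)} {j : ℕ}
    (hne : ∀ i < j + 1, (pending C i).Nonempty) :
    (pending C (j + 1)).card + 1 = (pending C j).card + (C j).card := by
  have hdisj : Disjoint ((pending C j).erase (leastString (pending C j)))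
      ((C j).image fun c => leastString (pending C j) ++ [c]) := by
    rw [Finset.disjoint_left]
    intro x hx hx'
    obtain ⟨c, -, rfl⟩ := Finset.mem_image.mp hx'
    rcases eq_nil_or_child_of_mem_pending (Finset.mem_of_mem_erase hx) with h | ⟨i, hi, c', -, h⟩
    · simp at h
    · have hlt := visited_strictMonoOn hne hi (Nat.lt_succ_self j)
      exact hlt.ne (List.append_inj_left' h rfl)
  have hmem := leastString_mem (hne j (Nat.lt_succ_self j))
  have hinj : Function.Injective fun c : Fin σ => leastString (pending C j) ++ [c] :=
    fun a b h => by simpa using h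
  have hpos : 0 < (pending C j).card := Finset.card_pos.mpr ⟨_, hmem⟩
  rw [pending, Finset.card_union_of_disjoint hdisj, Finset.card_erase_of_mem hmem,
    Finset.card_image_of_injective _ hinj]
  omega

/-- Discovered nodes are either visited or still pending. -/
theorem visited_or_mem_pending {σ : ℕ} {C : ℕ → Finset (Fin σ)} {k m : ℕ} (hkm : k ≤ m)
    {x : List (Fin σ)} (hx : x ∈ pending C k) :
    (∃ i < m, visited C i = x) ∨ x ∈ pending C m := by
  induction m, hkm using Nat.le_induction with
  | base => exact Or.inr hx
  | succ m _ ih =>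
    rcases ih with ⟨i, hi, h⟩ | h
    · exact Or.inl ⟨i, by omega, h⟩
    · by_cases hxm : x = visited C m
      · exact Or.inl ⟨m, by omega, hxm.symm⟩
      · exact Or.inr (mem_pending_succ.mpr (Or.inl ⟨hxm, h⟩))

/-- The set of rows holding a one in column `t`; empty when `t` is out of range. -/
def columnSet {σ n : ℕ} (M : Fin σ → Fin n → Bool) (t : ℕ) : Finset (Fin σ) :=
  if h : t < n then Finset.univ.filter fun i => M i ⟨t, h⟩ = true else ∅

theorem mem_columnSet {σ n : ℕ} {M : Fin σ → Fin n → Bool} {t : Fin n} {i : Fin σ} :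
    i ∈ columnSet M t ↔ M i t = true := by
  simp [columnSet]

theorem card_columnSet {σ n : ℕ} (M : Fin σ → Fin n → Bool) {t : ℕ} (ht : t < n) :
    (columnSet M t).card = colOnes σ n M ⟨t, ht⟩ := by
  simp [columnSet, ht, colOnes]

theorem card_pending_columnSet {σ n : ℕ} {M : Fin σ → Fin n → Bool}
    (hL : ∀ j < n, 0 ≤ Lseq σ n M j) {j : ℕ} (hj : j ≤ n) :
    ((pending (columnSet M) j).card : ℤ) = Lseq σ n M j + 1 := by
  induction j using Nat.strong_induction_on with
  | _ j ih =>
    cases j with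
    | zero => simp [pending, Lseq_zero]
    | succ j =>
      have hne : ∀ i < j + 1, (pending (columnSet M) i).Nonempty := by
        intro i hi
        have h1 := ih i hi (by omega)
        have h2 := hL i (by omega)
        exact Finset.card_pos.mp (by omega)
      have h1 := card_pending_succ hne
      have h2 := ih j (by omega) (by omega)
      have h3 := card_columnSet M (show j < n by omega)
      rw [Lseq_succ σ n M (show j < n by omega)]
      omega

/-- Every matrix whose sequence is a Łukasiewicz path comes from a trie. -/
theorem exists_trie_of_Lseq {σ n : ℕ} (hn : 1 ≤ n) {M : Fin σ → Fin n → Bool}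
    (hL : ∀ j < n, 0 ≤ Lseq σ n M j) (hend : Lseq σ n M n = -1) :
    ∃ S : Finset (List (Fin σ)), S.card = n ∧ [] ∈ S ∧
      (∀ (s : List (Fin σ)) (c : Fin σ), s ++ [c] ∈ S → s ∈ S) ∧
      trieMatrix σ n S = M := by
  let C := columnSet M
  have hne : ∀ j < n, (pending C j).Nonempty := fun j hj => by
    have h1 : ((pending C j).card : ℤ) = _ := card_pending_columnSet hL hj.le
    have h2 := hL j hj
    exact Finset.card_pos.mp (by omega)
  have hempty : pending C n = ∅ := by
    have h1 : ((pending C n).card : ℤ) = _ := card_pending_columnSet hL le_rfl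
    exact Finset.card_eq_zero.mp (by omega)
  let s : Fin n → List (Fin σ) := fun j => visited C j
  have hmono : StrictMono s := fun i j hij => visited_strictMonoOn hne hij j.2
  let S := Finset.univ.image s
  have hsS : ∀ j, s j ∈ S := fun j => Finset.mem_image_of_mem s (Finset.mem_univ j)
  have hS : S.card = n := by
    simp [S, Finset.card_image_of_injective _ hmono.injective]
  have hchild : ∀ x c, x ++ [c] ∈ S → ∃ i, s i = x ∧ M c i = true := by
    intro x c hx
    obtain ⟨j, -, hj⟩ := Finset.mem_image.mp hx
    have hmem : visited C j ∈ pending C j := leastString_mem (hne j j.2)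
    change visited C j = _ at hj
    rw [hj] at hmem
    rcases eq_nil_or_child_of_mem_pending hmem with h | ⟨i, hi, c', hc', h⟩
    · simp at h
    · obtain ⟨h1, h2⟩ := List.append_inj' h rfl
      obtain rfl : c' = c := by simpa using h2
      exact ⟨⟨i, hi.trans j.2⟩, h1, mem_columnSet.mp hc'⟩
  have hdone : ∀ k ≤ n, ∀ x ∈ pending C k, x ∈ S := by
    intro k hk x hx
    rcases visited_or_mem_pending hk hx with ⟨i, hi, rfl⟩ | h
    · exact hsS ⟨i, hi⟩
    · simp [hempty] at h
  refine ⟨S, hS, hdone 0 (by omega) [] (by simp [pending]), ?_, ?_⟩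
  · intro x c hx
    obtain ⟨i, rfl, -⟩ := hchild x c hx
    exact hsS i
  · funext c j
    rw [Bool.eq_iff_iff, trieMatrix_eq_true_iff hS,
      ← congrFun (Finset.orderEmbOfFin_unique hS hsS hmono) j]
    constructor
    · intro h
      obtain ⟨i, hi, hM⟩ := hchild _ _ h
      rwa [hmono.injective hi] at hM
    · intro h
      exact hdone (j + 1) j.2 _ (mem_pending_succ.mpr (Or.inr ⟨c, mem_columnSet.mpr h, rfl⟩))

/-- The row sums of the matrix of a trie form its symbol distribution. -/
theorem card_filter_getLast?_eq {σ n : ℕ} {S : Finset (List (Fin σ))} (hS : S.card = n)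
    (hpre : ∀ (s : List (Fin σ)) (c : Fin σ), s ++ [c] ∈ S → s ∈ S) (i : Fin σ) :
    (S.filter fun s => s.getLast? = some i).card =
      (Finset.univ.filter fun j => trieMatrix σ n S i j = true).card := by
  have hinj : Function.Injective fun j : Fin n => S.orderEmbOfFin hS j ++ [i] :=
    fun a b h => (S.orderEmbOfFin hS).injective (List.append_inj_left' h rfl)
  rw [← Finset.card_image_of_injective _ hinj]
  congr 1
  ext x
  simp only [Finset.mem_filter, Finset.mem_image, Finset.mem_univ, true_and,
    trieMatrix_eq_true_iff hS]
  constructor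
  · rintro ⟨hx, hlast⟩
    obtain ⟨p, rfl⟩ := List.getLast?_eq_some_iff.mp hlast
    have hr : p ∈ Set.range (S.orderEmbOfFin hS) := by
      rw [Finset.range_orderEmbOfFin]; exact hpre p i hx
    obtain ⟨j, rfl⟩ := hr
    exact ⟨j, hx, rfl⟩
  · rintro ⟨j, hj, rfl⟩
    exact ⟨hj, by simp⟩

/-- `f` is injective on the set `𝓤` of tries with `n` nodes and symbol
distribution `nd`, and a matrix `M ∈ 𝓜` belongs to the image `f(𝓤)` iff its
associated sequence `L` is a Łukasiewicz path. -/
theorem stmt2 (σ n : ℕ) (hn : 1 ≤ n) (nd : Fin σ → ℕ)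
    (hsum : ∑ i, nd i = n - 1) :
    Set.InjOn (trieMatrix σ n) {S : Finset (List (Fin σ)) |
        S.card = n ∧ ([] : List (Fin σ)) ∈ S ∧
        (∀ (s : List (Fin σ)) (c : Fin σ), s ++ [c] ∈ S → s ∈ S) ∧
        (∀ i : Fin σ, (S.filter (fun s => s.getLast? = some i)).card = nd i)} ∧
    ∀ M : Fin σ → Fin n → Bool,
      (∀ i, (Finset.univ.filter fun j => M i j = true).card = nd i) →
      (M ∈ trieMatrix σ n '' {S : Finset (List (Fin σ)) |
          S.card = n ∧ ([] : List (Fin σ)) ∈ S ∧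
          (∀ (s : List (Fin σ)) (c : Fin σ), s ++ [c] ∈ S → s ∈ S) ∧
          (∀ i : Fin σ, (S.filter (fun s => s.getLast? = some i)).card = nd i)} ↔
        IsLukasiewicz n (Lseq σ n M)) := by
  refine ⟨?_, ?_⟩
  · rintro S ⟨hS, hSnil, hSpre, -⟩ T ⟨hT, hTnil, hTpre, -⟩ hM
    exact eq_of_trieMatrix_eq hS hSnil hSpre hT hTnil hTpre hM
  · intro M hM
    have hend := Lseq_eq_neg_one σ n hn nd hsum M hM
    constructor
    · rintro ⟨S, ⟨hS, -, hpre, -⟩, rfl⟩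
      refine ⟨hend, fun j _ hj => Lseq_trieMatrix_nonneg hS hpre (by omega),
        fun j _ hj => ?_⟩
      rw [Lseq_succ σ n _ (show j < n by omega)]
      omega
    · rintro ⟨-, hnonneg, -⟩
      have hL : ∀ j < n, 0 ≤ Lseq σ n M j := by
        intro j hj
        rcases Nat.eq_zero_or_pos j with rfl | h
        · rw [Lseq_zero]
        · exact hnonneg j h (by omega)
      obtain ⟨S, hS, hnil, hpre, rfl⟩ := exists_trie_of_Lseq hn hL hend
      exact ⟨S, ⟨hS, hnil, hpre, fun i => (card_filter_getLast?_eq hS hpre i).trans (hM i)⟩, rfl⟩
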